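/- Let N ≥ 1 and define Z(x_1, …, x_N, y) = (1/π^N) · ∏_{k=1}^{N} ( k! / (y − x_k)^{N+1} ) · ∏_{1 ≤ i < j ≤ N} (x_j − x_i) for x_1 < ⋯ < x_N < y. Let a, b, c, d ∈ ℝ with ad − bc > 0, set φ(u) = (a u + b)/(c u + d) and φ'(u) = (ad − bc)/(c u + d)², and assume c x_i + d ≠ 0 for all i, c y + d ≠ 0, and φ(x_1) < ⋯ < φ(x_N) < φ(y). Then Z(x_1, …, x_N, y) = ( ∏_{j=1}^{N} |φ'(x_j)| ) · |φ'(y)|^{N(N+1)/2} · Z(φ(x_1), …, φ(x_N), φ(y)). -/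

import Mathlib

open scoped BigOperators

/-- The explicit pure partition function of the fused rainbow (half-watermelon) pattern
from Appendix C.2 of the paper. -/
noncomputable def Zrainbow (N : ℕ) (p : (Fin N → ℝ) × ℝ) : ℝ :=
  (1 / Real.pi ^ N) *
    (∏ k : Fin N, ((k.1 + 1).factorial : ℝ) / (p.2 - p.1 k) ^ (N + 1)) *
    (∏ i : Fin N, ∏ j ∈ Finset.Ioi i, (p.1 j - p.1 i))

/-- Differences transform under a Möbius map by the square roots `s / (C u + D)` of its
derivatives at the two points. -/
lemma moebius_sub_moebius {A B C D s u v : ℝ} (hs : s ^ 2 = A * D - B * C)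
    (hu : C * u + D ≠ 0) (hv : C * v + D ≠ 0) :
    (A * v + B) / (C * v + D) - (A * u + B) / (C * u + D) =
      (v - u) * (s / (C * u + D) * (s / (C * v + D))) := by
  rw [div_mul_div_comm, ← sq, hs, div_sub_div _ _ hv hu, ← mul_div_assoc,
    mul_comm (C * u + D) (C * v + D)]
  ring

lemma prod_prod_Ioi_mul_eq_prod_pow {M : Type*} [CommMonoid M] {N : ℕ} (g : Fin N → M) :
    ∏ i, ∏ j ∈ Finset.Ioi i, g i * g j = ∏ i, g i ^ (N - 1) := by
  rw [Finset.prod_prod_Ioi_mul_eq_prod_prod_off_diag (fun _ i => g i)]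
  simp [Finset.card_compl]

/-- Scaling law of `Zrainbow` when differences are rescaled by local factors. -/
lemma Zrainbow_eq_of_sub_eq {N : ℕ} (hN : 1 ≤ N) {x x' g : Fin N → ℝ} {y y' w : ℝ}
    (hg : ∀ i, g i ≠ 0) (hw : w ≠ 0)
    (hx : ∀ i j, x' j - x' i = (x j - x i) * (g i * g j))
    (hy : ∀ i, y' - x' i = (y - x i) * (g i * w)) :
    Zrainbow N (x, y) = (∏ i, g i ^ 2) * w ^ (N * (N + 1)) * Zrainbow N (x', y') := by
  have hP : ∏ i, g i ≠ 0 := Finset.prod_ne_zero_iff.mpr fun i _ => hg i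
  obtain ⟨n, rfl⟩ := Nat.exists_eq_add_of_le' hN
  have hV : ∏ i, ∏ j ∈ Finset.Ioi i, (x' j - x' i) =
      (∏ i, ∏ j ∈ Finset.Ioi i, (x j - x i)) * (∏ i, g i) ^ n := by
    simp_rw [hx, Finset.prod_mul_distrib (f := fun j => x j - x _)]
    rw [Finset.prod_mul_distrib, prod_prod_Ioi_mul_eq_prod_pow, Finset.prod_pow,
      Nat.add_sub_cancel]
  simp only [Zrainbow, hV, hy, mul_pow, Finset.prod_div_distrib, Finset.prod_mul_distrib,
    Finset.prod_pow, Finset.prod_const, Finset.card_univ, Fintype.card_fin]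
  field_simp
  ring

/-- Möbius covariance (property (COV) of Theorem 1.3 of the paper) for the explicit fused
rainbow pure partition function: the unfused points `x_j` carry conformal weight `1` and the
fused point `y` carries the Kac weight `h_{1,N+1} = N(N+1)/2`. -/
theorem stmt9 (N : ℕ) (hN : 1 ≤ N) (x : Fin N → ℝ) (y : ℝ)
    (hx : ∀ i k : Fin N, i < k → x i < x k) (hy : ∀ i, x i < y)
    (A B C D : ℝ) (h : 0 < A * D - B * C)
    (hxden : ∀ i, C * x i + D ≠ 0) (hyden : C * y + D ≠ 0)
    (hord : ∀ i k : Fin N, i < k →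
      (A * x i + B) / (C * x i + D) < (A * x k + B) / (C * x k + D))
    (hordy : ∀ i, (A * x i + B) / (C * x i + D) < (A * y + B) / (C * y + D)) :
    Zrainbow N (x, y) =
      (∏ j : Fin N, |(A * D - B * C) / (C * x j + D) ^ 2|) *
        |(A * D - B * C) / (C * y + D) ^ 2| ^ (N * (N + 1) / 2) *
        Zrainbow N (fun i => (A * x i + B) / (C * x i + D), (A * y + B) / (C * y + D)) := by
  set s := √(A * D - B * C)
  have hs : s ^ 2 = A * D - B * C := Real.sq_sqrt h.le
  have hs0 : s ≠ 0 := (Real.sqrt_pos.mpr h).ne'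
  have abs_deriv (u : ℝ) :
      |(A * D - B * C) / (C * u + D) ^ 2| = (s / (C * u + D)) ^ 2 := by
    rw [← hs, ← div_pow, abs_of_nonneg (sq_nonneg _)]
  simp only [abs_deriv]
  rw [← pow_mul, Nat.mul_div_cancel' (Nat.even_mul_succ_self N).two_dvd]
  exact Zrainbow_eq_of_sub_eq hN (fun i => div_ne_zero hs0 (hxden i)) (div_ne_zero hs0 hyden)
    (fun i j => moebius_sub_moebius hs (hxden i) (hxden j))
    (fun i => moebius_sub_moebius hs (hxden i) hyden)
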